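/- Let X be an infinite-dimensional complex Banach space and T a bounded linear operator on X. Then for every ε > 0 there exists a bounded linear operator F on X of rank at most one with ‖F‖ ≤ ε such that T + F has an invariant half-space, i.e., there is a closed subspace Y of X with infinite dimension and infinite codimension such that (T + F)(Y) ⊆ Y. -/

import Mathlib

open Filter Topology Metric Set Polynomial

namespace RankOneHalfspace

variable {X : Type*} [NormedAddCommGroup X] [NormedSpace ℂ X]

/-- The conclusion: an invariant half-space for `A`. -/
def HasHalfspace (A : X →L[ℂ] X) : Prop :=
  ∃ Y : Submodule ℂ X, IsClosed (Y : Set X) ∧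
        ¬ FiniteDimensional ℂ Y ∧ ¬ FiniteDimensional ℂ (X ⧸ Y) ∧
        ∀ y ∈ Y, A y ∈ Y

/-- Conclusion of the main theorem. -/
def Good (T : X →L[ℂ] X) (ε : ℝ) : Prop :=
  ∃ F : X →L[ℂ] X,
      Module.rank ℂ (LinearMap.range (F : X →ₗ[ℂ] X)) ≤ 1 ∧ ‖F‖ ≤ ε ∧ HasHalfspace (T + F)

lemma hahn_banach_sub (Y : Submodule ℂ X) (hY : IsClosed (Y : Set X)) {x : X} (hx : x ∉ Y) :
    ∃ g : X →L[ℂ] ℂ, (∀ y ∈ Y, g y = 0) ∧ g x = 1 := by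
  have : IsClosed (Y : Set X) := hY
  have h1 : Y.mkQ x ≠ 0 := by
    simpa [Submodule.Quotient.mk_eq_zero] using hx
  obtain ⟨g, -, hg⟩ := exists_dual_vector ℂ (Y.mkQ x) (norm_ne_zero_iff.mpr h1)
  have h2 : g (Y.mkQ x) ≠ 0 := by rw [hg]; exact Complex.ofReal_ne_zero.mpr (norm_ne_zero_iff.mpr h1)
  refine ⟨(g (Y.mkQ x))⁻¹ • g.comp Y.mkQL, ?_, ?_⟩
  · intro y hy
    have : Y.mkQL y = 0 := by
      simpa [Submodule.Quotient.mk_eq_zero] using hy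
    simp [this]
  · change (g (Y.mkQ x))⁻¹ * g (Y.mkQ x) = 1
    exact inv_mul_cancel₀ h2

lemma halfspace_of_seq (A : X →L[ℂ] X) (x : ℕ → X) (g : ℕ → X →L[ℂ] ℂ)
    (hx : LinearIndependent ℂ x) (hg : LinearIndependent ℂ g)
    (hgx : ∀ i j, i ≠ j → g i (x j) = 0)
    (hA : ∀ i, ∃ c : ℂ, A (x i) = c • x i) : HasHalfspace A := by
  set S : Submodule ℂ X := Submodule.span ℂ (range fun n => x (2 * n)) with hS
  have hinj : Function.Injective fun n : ℕ => 2 * n := fun a b h => by simpa using h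
  have hinj' : Function.Injective fun n : ℕ => 2 * n + 1 := fun a b h => by simpa using h
  refine ⟨S.topologicalClosure, S.isClosed_topologicalClosure, ?_, ?_, ?_⟩
  · intro hfin
    have h1 : LinearIndependent ℂ (fun n => x (2 * n)) := hx.comp _ hinj
    have h2 : LinearIndependent ℂ (fun n : ℕ => (⟨x (2 * n),
        S.le_topologicalClosure (Submodule.subset_span ⟨n, rfl⟩)⟩ : S.topologicalClosure)) := by
      apply LinearIndependent.of_comp S.topologicalClosure.subtype
      exact h1
    have := h2.finite
    exact not_finite ℕ
  · intro hfin
    have hker : ∀ n, S.topologicalClosure ≤ LinearMap.ker (g (2 * n + 1) : X →ₗ[ℂ] ℂ) := by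
      intro n
      apply Submodule.topologicalClosure_minimal
      · rw [hS, Submodule.span_le]
        rintro _ ⟨m, rfl⟩
        exact hgx _ _ (by lia)
      · exact (g (2 * n + 1)).isClosed_ker
    let G : ℕ → (X ⧸ S.topologicalClosure) →ₗ[ℂ] ℂ := fun n =>
      S.topologicalClosure.liftQ (g (2 * n + 1) : X →ₗ[ℂ] ℂ) (hker n)
    have h1 : LinearIndependent ℂ (fun n => g (2 * n + 1)) := hg.comp _ hinj'
    have h1' : LinearIndependent ℂ (fun n => (g (2 * n + 1) : X →ₗ[ℂ] ℂ)) := by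
      have := h1.map' (ContinuousLinearMap.coeLM ℂ : (X →L[ℂ] ℂ) →ₗ[ℂ] (X →ₗ[ℂ] ℂ))
        (LinearMap.ker_eq_bot.mpr ContinuousLinearMap.coe_injective)
      exact this
    have h2 : LinearIndependent ℂ G := by
      apply LinearIndependent.of_comp (LinearMap.lcomp ℂ ℂ S.topologicalClosure.mkQ)
      exact h1'
    have := h2.finite
    exact not_finite ℕ
  · have h0 : S ≤ S.comap (A : X →ₗ[ℂ] X) := by
      rw [hS, Submodule.span_le]
      rintro _ ⟨m, rfl⟩
      obtain ⟨c, hc⟩ := hA (2 * m)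
      change A (x (2 * m)) ∈ Submodule.span ℂ (range fun n => x (2 * n))
      rw [hc]
      exact Submodule.smul_mem _ _ (Submodule.subset_span ⟨m, rfl⟩)
    have h1 : S.topologicalClosure ≤ S.topologicalClosure.comap (A : X →ₗ[ℂ] X) := by
      apply Submodule.topologicalClosure_minimal
      · exact h0.trans (Submodule.comap_mono S.le_topologicalClosure)
      · exact S.isClosed_topologicalClosure.preimage A.continuous
    exact fun y hy => h1 hy

/-- infinite dimensional eigenspace -/
lemma halfspace_of_ker (A : X →L[ℂ] X) (d : ℂ) (K : Submodule ℂ X) (hK : ¬ FiniteDimensional ℂ K)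
    (hA : ∀ x ∈ K, A x = d • x) : HasHalfspace A := by
  classical
  obtain ⟨p, hp1, hp2⟩ := exists_seq_of_forall_finset_exists
    (fun q : X × (X →L[ℂ] ℂ) => q.1 ∈ K ∧ q.2 q.1 = 1)
    (fun q q' => q.2 q'.1 = 0 ∧ q'.2 q.1 = 0) (by
      intro s hs
      let S : Submodule ℂ X := Submodule.span ℂ ((s.image Prod.fst : Finset X) : Set X)
      let G : K →ₗ[ℂ] (s → ℂ) :=
        LinearMap.pi fun q => (q.1.2 : X →ₗ[ℂ] ℂ).comp K.subtype
      obtain ⟨x, hxK, hxG, hxS⟩ : ∃ x : X, ∃ h : x ∈ K, G ⟨x, h⟩ = 0 ∧ x ∉ S := by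
        by_contra hcon
        push Not at hcon
        apply hK
        have hle : (LinearMap.ker G).map K.subtype ≤ S := by
          rintro _ ⟨⟨x, hx⟩, hx1, rfl⟩
          exact hcon x hx hx1
        have hSf : FiniteDimensional ℂ S := FiniteDimensional.span_finset ℂ _
        have h1 : FiniteDimensional ℂ ((LinearMap.ker G).map K.subtype) :=
          Submodule.finiteDimensional_of_le hle
        have h2 : (LinearMap.ker G).FG := by
          have h3 : ((LinearMap.ker G).map K.subtype).FG := Module.Finite.iff_fg.mp h1
          exact Submodule.fg_of_fg_map_injective _ K.injective_subtype h3
        have h4 : (⊤ : Submodule ℂ K).FG := by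
          apply Submodule.fg_of_fg_map_of_fg_inf_ker G
          · exact IsNoetherian.noetherian _
          · simpa using h2
        exact ⟨h4⟩
      have hSf : FiniteDimensional ℂ S := FiniteDimensional.span_finset ℂ _
      obtain ⟨g, hg0, hg1⟩ := hahn_banach_sub S S.closed_of_finiteDimensional hxS
      refine ⟨(x, g), ⟨hxK, hg1⟩, fun q hq => ⟨?_, ?_⟩⟩
      · exact congrFun hxG ⟨q, hq⟩
      · exact hg0 _ (Submodule.subset_span (by simpa using ⟨q.2, hq⟩)))
  have hgx : ∀ i j, i ≠ j → (p i).2 (p j).1 = 0 := by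
    intro i j hij
    rcases lt_or_gt_of_ne hij with h | h
    · exact (hp2 i j h).1
    · exact (hp2 j i h).2
  refine halfspace_of_seq A (fun n => (p n).1) (fun n => (p n).2) ?_ ?_ hgx
    (fun i => ⟨d, hA _ (hp1 i).1⟩)
  · rw [linearIndependent_iff']
    intro s c hc i hi
    have := congrArg (p i).2 hc
    simp only [map_sum, map_smul, map_zero] at this
    rw [Finset.sum_eq_single i] at this
    · simpa [(hp1 i).2] using this
    · intro j _ hj
      simp [hgx i j hj.symm]
    · exact fun h => absurd hi h
  · rw [linearIndependent_iff']
    intro s c hc i hi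
    have := congrArg (fun f : X →L[ℂ] ℂ => f (p i).1) hc
    simp only [sum_apply, smul_apply,
      zero_apply] at this
    rw [Finset.sum_eq_single i] at this
    · simpa [(hp1 i).2] using this
    · intro j _ hj
      simp [hgx j i hj]
    · exact fun h => absurd hi h

lemma good_zero (T : X →L[ℂ] X) (ε : ℝ) (hε : 0 < ε) (h : HasHalfspace T) : Good T ε := by
  refine ⟨0, ?_, by simpa using hε.le, by simpa using h⟩
  rw [ContinuousLinearMap.toLinearMap_zero, LinearMap.range_zero]
  simp

lemma ker_fg_mul (A B : X →L[ℂ] X) (hA : (LinearMap.ker (A : X →ₗ[ℂ] X)).FG)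
    (hB : (LinearMap.ker (B : X →ₗ[ℂ] X)).FG) :
    (LinearMap.ker ((A * B : X →L[ℂ] X) : X →ₗ[ℂ] X)).FG := by
  apply Submodule.fg_of_fg_map_of_fg_inf_ker (B : X →ₗ[ℂ] X)
  · have : FiniteDimensional ℂ (LinearMap.ker (A : X →ₗ[ℂ] X)) := Module.Finite.iff_fg.mpr hA
    apply Module.Finite.iff_fg.mp
    refine Submodule.finiteDimensional_of_le (S₂ := LinearMap.ker (A : X →ₗ[ℂ] X)) ?_
    rintro _ ⟨x, hx, rfl⟩
    exact hx
  · have : FiniteDimensional ℂ (LinearMap.ker (B : X →ₗ[ℂ] X)) := Module.Finite.iff_fg.mpr hB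
    apply Module.Finite.iff_fg.mp
    exact Submodule.finiteDimensional_of_le inf_le_right

lemma halfspace_of_algebraic (hX : ¬ FiniteDimensional ℂ X) (T : X →L[ℂ] X) (s : Finset ℂ) (n : ℕ)
    (h : (aeval T (∏ d ∈ s, (Polynomial.X - C d : ℂ[X]))) ^ n = 0) : HasHalfspace T := by
  by_contra hcon
  have hk : ∀ d : ℂ,
      (LinearMap.ker ((aeval T (Polynomial.X - C d : ℂ[X]) : X →L[ℂ] X) : X →ₗ[ℂ] X)).FG := by
    intro d
    by_contra hd
    apply hcon
    refine halfspace_of_ker T d _ (fun hf => hd (Module.Finite.iff_fg.mp hf)) ?_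
    intro x hx
    have : (aeval T (Polynomial.X - C d : ℂ[X]) : X →L[ℂ] X) x = 0 := hx
    simpa [sub_eq_zero, Algebra.algebraMap_eq_smul_one] using this
  have h1 : (LinearMap.ker ((1 : X →L[ℂ] X) : X →ₗ[ℂ] X)).FG := by
    have : LinearMap.ker ((1 : X →L[ℂ] X) : X →ₗ[ℂ] X) = ⊥ := LinearMap.ker_id
    rw [this]; exact Submodule.fg_bot
  have hp : (LinearMap.ker ((aeval T (∏ d ∈ s, (Polynomial.X - C d : ℂ[X])) : X →L[ℂ] X)
      : X →ₗ[ℂ] X)).FG := by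
    refine Finset.prod_induction _
      (fun q : ℂ[X] => (LinearMap.ker ((aeval T q : X →L[ℂ] X) : X →ₗ[ℂ] X)).FG) ?_ ?_ ?_
    · intro a b ha hb
      rw [map_mul]
      exact ker_fg_mul _ _ ha hb
    · rw [map_one]; exact h1
    · exact fun d _ => hk d
  have hpn : ∀ m : ℕ, (LinearMap.ker (((aeval T (∏ d ∈ s, (Polynomial.X - C d : ℂ[X]))) ^ m
      : X →L[ℂ] X) : X →ₗ[ℂ] X)).FG := by
    intro m
    induction m with
    | zero => rw [pow_zero]; exact h1
    | succ m ih => rw [pow_succ]; exact ker_fg_mul _ _ ih hp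
  have := hpn n
  rw [h, ContinuousLinearMap.toLinearMap_zero, LinearMap.ker_zero] at this
  exact hX ⟨this⟩

section Resolvent

variable [CompleteSpace X] (T : X →L[ℂ] X)

/-- The scalar resolvent function. -/
noncomputable def phi (u : X) (f : X →L[ℂ] ℂ) (z : ℂ) : ℂ := f (resolvent T z u)

variable {T}

lemma T_res {z : ℂ} (hz : z ∈ resolventSet ℂ T) (u : X) :
    T (resolvent T z u) = z • resolvent T z u - u := by
  have h : (algebraMap ℂ (X →L[ℂ] X) z - T) * resolvent T z = 1 := Ring.mul_inverse_cancel _ hz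
  have h1 := congrArg (fun A : X →L[ℂ] X => A u) h
  simp only [sub_mul, Algebra.algebraMap_eq_smul_one] at h1
  have h2 : z • resolvent T z u - T (resolvent T z u) = u := by simpa using h1
  rw [← sub_eq_iff_eq_add'.mpr (sub_eq_iff_eq_add.mp h2)]

lemma res_T {z : ℂ} (hz : z ∈ resolventSet ℂ T) (u : X) :
    resolvent T z (T u) = z • resolvent T z u - u := by
  have h : resolvent T z * (algebraMap ℂ (X →L[ℂ] X) z - T) = 1 := Ring.inverse_mul_cancel _ hz
  have h1 := congrArg (fun A : X →L[ℂ] X => A u) h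
  simp only [mul_sub, Algebra.algebraMap_eq_smul_one] at h1
  have h2 : z • resolvent T z u - resolvent T z (T u) = u := by simpa using h1
  rw [← sub_eq_iff_eq_add'.mpr (sub_eq_iff_eq_add.mp h2)]

lemma phi_diff (u : X) (f : X →L[ℂ] ℂ) {z : ℂ} (hz : z ∈ resolventSet ℂ T) :
    DifferentiableAt ℂ (phi T u f) z := by
  have h := (spectrum.hasDerivAt_resolvent_const_left hz).differentiableAt
  have h2 : DifferentiableAt ℂ (fun z => resolvent T z u) z :=
    h.clm_apply (differentiableAt_const u)
  exact f.differentiableAt.comp z h2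

lemma phi_analytic (u : X) (f : X →L[ℂ] ℂ) {z : ℂ} (hz : z ∈ resolventSet ℂ T) :
    AnalyticAt ℂ (phi T u f) z := by
  have h : DifferentiableOn ℂ (phi T u f) (resolventSet ℂ T) :=
    fun w hw => (phi_diff u f hw).differentiableWithinAt
  exact h.analyticAt ((spectrum.isOpen_resolventSet T).mem_nhds hz)

lemma norm_res_ge {z d : ℂ} (hz : z ∈ resolventSet ℂ T) (hd : d ∈ spectrum ℂ T) :
    1 ≤ ‖z - d‖ * ‖resolvent T z‖ := by
  by_contra hcon
  push Not at hcon
  apply hd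
  have h1 : ‖(z - d) • resolvent T z‖ < 1 := by rwa [norm_smul]
  have h2 := isUnit_one_sub_of_norm_lt_one h1
  have h3 : (algebraMap ℂ (X →L[ℂ] X) z - T) * (1 - (z - d) • resolvent T z)
      = algebraMap ℂ (X →L[ℂ] X) d - T := by
    have h : (algebraMap ℂ (X →L[ℂ] X) z - T) * resolvent T z = 1 := Ring.mul_inverse_cancel _ hz
    rw [mul_sub, mul_smul_comm, h, mul_one]
    simp only [Algebra.algebraMap_eq_smul_one, sub_smul]
    abel
  change IsUnit _
  rw [← h3]
  exact IsUnit.mul hz h2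

/-- Infinitely many solutions of `φ = c` give the conclusion. -/
lemma good_of_infinite (ε : ℝ) (u : X) (f : X →L[ℂ] ℂ) (c : ℂ) (hc : c ≠ 0)
    (hb : ‖u‖ * ‖f‖ ≤ ε * ‖c‖) (S : Set ℂ) (hS : S.Infinite) (hSr : S ⊆ resolventSet ℂ T)
    (hSc : ∀ z ∈ S, phi T u f z = c) : Good T ε := by
  refine ⟨c⁻¹ • f.smulRight u, ?_, ?_, ?_⟩
  · rw [rank_le_one_iff]
    refine ⟨⟨c⁻¹ • u, ?_⟩, ?_⟩
    · obtain ⟨z, hz⟩ := hS.nonempty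
      refine ⟨c⁻¹ • resolvent T z u, ?_⟩
      have : f (resolvent T z u) = c := hSc z hz
      simp [this, hc]
    · rintro ⟨_, v, rfl⟩
      refine ⟨f v, ?_⟩
      ext
      simp [smul_smul, mul_comm]
  · rw [norm_smul, norm_inv, ContinuousLinearMap.norm_smulRight_apply]
    have : 0 < ‖c‖ := norm_pos_iff.mpr hc
    rw [inv_mul_le_iff₀ this]
    linarith [mul_comm ‖u‖ ‖f‖, mul_comm ε ‖c‖]
  · set A : X →L[ℂ] X := T + c⁻¹ • f.smulRight u with hA
    let e := hS.natEmbedding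
    let m : ℕ → ℂ := fun n => (e n : ℂ)
    have hm : Function.Injective m := Subtype.val_injective.comp e.injective
    have hmr : ∀ n, m n ∈ resolventSet ℂ T := fun n => hSr (e n).2
    have hmc : ∀ n, f (resolvent T (m n) u) = c := fun n => hSc _ (e n).2
    have hx : ∀ n, A (resolvent T (m n) u) = m n • resolvent T (m n) u := by
      intro n
      simp [hA, T_res (hmr n), hmc n, hc]
    have hg : ∀ n v, f (resolvent T (m n) (A v)) = m n * f (resolvent T (m n) v) := by
      intro n v
      simp [hA, res_T (hmr n), hmc n]
      field_simp
      ring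
    refine halfspace_of_seq A (fun n => resolvent T (m n) u)
      (fun n => f.comp (resolvent T (m n))) ?_ ?_ ?_ (fun i => ⟨m i, hx i⟩)
    · refine Module.End.eigenvectors_linearIndependent' (A : X →ₗ[ℂ] X) m hm _ ?_
      intro i
      refine ⟨Module.End.mem_eigenspace_iff.mpr (hx i), ?_⟩
      intro h0
      have := hmc i
      rw [h0, map_zero] at this
      exact hc this.symm
    · let B : Module.End ℂ (X →L[ℂ] ℂ) :=
        { toFun := fun h => h.comp A
          map_add' := fun _ _ => rfl
          map_smul' := fun _ _ => rfl }
      refine Module.End.eigenvectors_linearIndependent' B m hm _ ?_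
      intro i
      refine ⟨Module.End.mem_eigenspace_iff.mpr ?_, ?_⟩
      · ext v
        exact hg i v
      · intro h0
        have := hmc i
        have h1 := congrArg (fun h : X →L[ℂ] ℂ => h u) h0
        exact hc (this.symm.trans h1)
    · intro i j hij
      change f (resolvent T (m i) (resolvent T (m j) u)) = 0
      have h1 := hg i (resolvent T (m j) u)
      rw [hx j] at h1
      simp only [map_smul, smul_eq_mul] at h1
      have h2 : (m j - m i) * f (resolvent T (m i) (resolvent T (m j) u)) = 0 := by
        rw [sub_mul, h1, sub_self]
      rcases mul_eq_zero.mp h2 with h | h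
      · exact absurd (hm (sub_eq_zero.mp h)) hij.symm
      · exact h

/-- Dense images near a spectral point give the conclusion. -/
lemma good_of_dense (ε : ℝ) (hε : 0 < ε) (u : X) (f : X →L[ℂ] ℂ) (d : ℂ)
    (hd : d ∈ spectrum ℂ T)
    (h : ∀ η > 0, Dense (phi T u f '' (resolventSet ℂ T ∩ ball d η))) : Good T ε := by
  by_contra hcon
  set M : ℝ := ‖u‖ * ‖f‖ / ε with hM
  have hM0 : 0 ≤ M := by positivity
  have key : ∀ c : ℂ, M < ‖c‖ → ∀ S : Set ℂ, S.Infinite → S ⊆ resolventSet ℂ T →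
      (∀ z ∈ S, phi T u f z = c) → False := by
    intro c hc S h1 h2 h3
    refine hcon (good_of_infinite ε u f c ?_ ?_ S h1 h2 h3)
    · exact norm_pos_iff.mp (hM0.trans_lt hc)
    · rw [hM, div_lt_iff₀ hε] at hc
      linarith
  let O : ℕ → Set ℂ := fun n =>
    (phi T u f '' (resolventSet ℂ T ∩ ball d (1 / (n + 1))) ∩ {c | M < ‖c‖}) ∪ ball 0 (M + 1)
  have hO : ∀ n, IsOpen (O n) := by
    intro n
    refine IsOpen.union ?_ isOpen_ball
    rw [isOpen_iff_mem_nhds]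
    rintro _ ⟨⟨z, ⟨hz1, hz2⟩, rfl⟩, hz3⟩
    have hopen : resolventSet ℂ T ∩ ball d (1 / (n + 1)) ∈ 𝓝 z :=
      ((spectrum.isOpen_resolventSet T).inter isOpen_ball).mem_nhds ⟨hz1, hz2⟩
    refine Filter.inter_mem ?_ ((isOpen_lt continuous_const continuous_norm).mem_nhds hz3)
    rcases (phi_analytic u f hz1).eventually_constant_or_nhds_le_map_nhds with h1 | h1
    · exfalso
      have h2 : {w | phi T u f w = phi T u f z} ∩ (resolventSet ℂ T ∩ ball d (1 / (n + 1))) ∈ 𝓝 z :=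
        Filter.inter_mem h1 hopen
      exact key _ hz3 _ (infinite_of_mem_nhds z h2) (fun w hw => hw.2.1) (fun w hw => hw.1)
    · exact h1 (Filter.image_mem_map hopen)
  have hD : ∀ n, Dense (O n) := by
    intro n
    rw [dense_iff_inter_open]
    intro U hU hUn
    by_cases hUb : (U ∩ {c | M < ‖c‖}).Nonempty
    · obtain ⟨c, hcU, hc⟩ := (h (1 / (n + 1)) (by positivity)).inter_open_nonempty _
        (hU.inter (isOpen_lt continuous_const continuous_norm)) hUb
      exact ⟨c, hcU.1, Or.inl ⟨hc, hcU.2⟩⟩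
    · obtain ⟨c, hc⟩ := hUn
      refine ⟨c, hc, Or.inr ?_⟩
      have : ¬ M < ‖c‖ := fun hh => hUb ⟨c, hc, hh⟩
      rw [mem_ball_zero_iff]
      linarith
  obtain ⟨c, hc, hcO⟩ := (dense_iInter_of_isOpen hO hD).inter_open_nonempty {c : ℂ | M + 1 < ‖c‖}
    (isOpen_lt continuous_const continuous_norm) (by
      refine ⟨((M + 2 : ℝ) : ℂ), ?_⟩
      change M + 1 < ‖((M + 2 : ℝ) : ℂ)‖
      rw [Complex.norm_real, Real.norm_eq_abs, abs_of_nonneg (by linarith)]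
      linarith)
  change M + 1 < ‖c‖ at hc
  rw [mem_iInter] at hcO
  refine key c (by linarith) {z | z ∈ resolventSet ℂ T ∧ phi T u f z = c} ?_ (fun z hz => hz.1)
    (fun z hz => hz.2)
  intro hfin
  have hdn : d ∉ {z | z ∈ resolventSet ℂ T ∧ phi T u f z = c} := fun hh => hd hh.1
  obtain ⟨η, hη, hball⟩ := Metric.mem_nhds_iff.mp (hfin.isClosed.isOpen_compl.mem_nhds hdn)
  obtain ⟨n, hn⟩ := exists_nat_one_div_lt hη
  rcases hcO n with h1 | h1
  · obtain ⟨⟨z, ⟨hz1, hz2⟩, hz3⟩, -⟩ := h1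
    exact hball (ball_subset_ball hn.le hz2) ⟨hz1, hz3⟩
  · rw [mem_ball_zero_iff] at h1
    linarith

lemma exists_nonvanishing (Q : X →L[ℂ] X) (hQ : ∀ n : ℕ, Q ^ n ≠ 0) :
    ∃ (u : X) (f : X →L[ℂ] ℂ), ∀ n : ℕ, f ((Q ^ n) u) ≠ 0 := by
  have h1 : ∃ u : X, ∀ n : ℕ, (Q ^ n) u ≠ 0 := by
    by_contra hcon
    push Not at hcon
    obtain ⟨n, hn⟩ := nonempty_interior_of_iUnion_of_closed
      (f := fun n : ℕ => ((LinearMap.ker ((Q ^ n : X →L[ℂ] X) : X →ₗ[ℂ] X) : Submodule ℂ X) : Set X))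
      (fun n => (Q ^ n).isClosed_ker) (by
        ext x
        obtain ⟨n, hn⟩ := hcon x
        simp only [mem_iUnion, mem_univ, iff_true]
        exact ⟨n, hn⟩)
    have := Submodule.eq_top_of_nonempty_interior' _ hn
    apply hQ n
    ext x
    have hx : x ∈ LinearMap.ker ((Q ^ n : X →L[ℂ] X) : X →ₗ[ℂ] X) := by rw [this]; trivial
    exact hx
  obtain ⟨u, hu⟩ := h1
  refine ⟨u, ?_⟩
  by_contra hcon
  push Not at hcon
  let ev : ℕ → (X →L[ℂ] ℂ) →L[ℂ] ℂ := fun n => ContinuousLinearMap.apply ℂ ℂ ((Q ^ n) u)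
  obtain ⟨n, hn⟩ := nonempty_interior_of_iUnion_of_closed
    (f := fun n : ℕ => ((LinearMap.ker (ev n : (X →L[ℂ] ℂ) →ₗ[ℂ] ℂ) : Submodule ℂ _) : Set (X →L[ℂ] ℂ)))
    (fun n => (ev n).isClosed_ker) (by
      ext f
      obtain ⟨n, hn⟩ := hcon f
      simp only [mem_iUnion, mem_univ, iff_true]
      exact ⟨n, hn⟩)
  have := Submodule.eq_top_of_nonempty_interior' _ hn
  obtain ⟨g, -, hg⟩ := exists_dual_vector ℂ ((Q ^ n) u) (norm_ne_zero_iff.mpr (hu n))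
  have hg' : g ∈ LinearMap.ker (ev n : (X →L[ℂ] ℂ) →ₗ[ℂ] ℂ) := by rw [this]; trivial
  have hg2 : g ((Q ^ n) u) = 0 := hg'
  rw [hg] at hg2
  exact hu n (norm_eq_zero.mp (Complex.ofReal_eq_zero.mp hg2))

lemma phi_aeval (u : X) (f : X →L[ℂ] ℂ) (q : ℂ[X]) :
    ∃ e : ℂ → ℂ, Differentiable ℂ e ∧ ∀ z ∈ resolventSet ℂ T,
      phi T ((aeval T q : X →L[ℂ] X) u) f z = q.eval z * phi T u f z + e z := by
  induction q using Polynomial.induction_on with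
  | C a =>
    refine ⟨0, differentiable_const 0, fun z hz => ?_⟩
    simp [phi, Algebra.algebraMap_eq_smul_one]
  | add p q hp hq =>
    obtain ⟨e1, h1, h1'⟩ := hp
    obtain ⟨e2, h2, h2'⟩ := hq
    refine ⟨e1 + e2, h1.add h2, fun z hz => ?_⟩
    have a1 := h1' z hz
    have a2 := h2' z hz
    simp only [phi, map_add, add_apply, eval_add, Pi.add_apply] at a1 a2 ⊢
    rw [a1, a2]; ring
  | monomial n a ih =>
    obtain ⟨e1, h1, h1'⟩ := ih
    refine ⟨fun z => z * e1 z - f ((aeval T (C a * Polynomial.X ^ n) : X →L[ℂ] X) u),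
      (differentiable_id.mul h1).sub (differentiable_const _), fun z hz => ?_⟩
    have a1 := h1' z hz
    have h2 : (aeval T (C a * Polynomial.X ^ (n + 1)) : X →L[ℂ] X) u
        = T ((aeval T (C a * Polynomial.X ^ n) : X →L[ℂ] X) u) := by
      have : (C a * Polynomial.X ^ (n + 1) : ℂ[X]) = Polynomial.X * (C a * Polynomial.X ^ n) := by
        ring
      rw [this, map_mul, aeval_X]
      rfl
    rw [h2]
    simp only [phi] at a1 ⊢
    rw [res_T hz, map_sub, map_smul, a1]
    simp only [eval_mul, eval_C, eval_pow, eval_X, smul_eq_mul]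
    ring

lemma tendsto_phi (u : X) (f : X →L[ℂ] ℂ) : Tendsto (phi T u f) (cocompact ℂ) (𝓝 0) := by
  have h := spectrum.resolvent_tendsto_cobounded (𝕜 := ℂ) T
  rw [Metric.cobounded_eq_cocompact] at h
  have h2 : Continuous fun A : X →L[ℂ] X => f (A u) := by fun_prop
  have := (h2.tendsto 0).comp h
  simp only [zero_apply, map_zero] at this
  exact this

lemma exists_not_meromorphic (s : Finset ℂ) (hs : spectrum ℂ T ⊆ s) (u : X) (f : X →L[ℂ] ℂ)
    (h : ∀ n : ℕ, f (((aeval T (∏ d ∈ s, (Polynomial.X - C d : ℂ[X]))) ^ n : X →L[ℂ] X) u) ≠ 0) :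
    ∃ d ∈ s, ¬ MeromorphicAt (phi T u f) d := by
  by_contra hcon
  push Not at hcon
  choose! k hk using hcon
  set n := s.sup k with hn
  set q : ℂ[X] := (∏ d ∈ s, (Polynomial.X - C d : ℂ[X])) ^ n with hq
  have hqa : (aeval T q : X →L[ℂ] X) = (aeval T (∏ d ∈ s, (Polynomial.X - C d : ℂ[X]))) ^ n := by
    rw [hq, map_pow]
  have hE : Differentiable ℂ (fun z => q.eval z * phi T u f z) := by
    intro z
    by_cases hz : z ∈ s
    · have h1 := hk z hz
      have hle : k z ≤ n := Finset.le_sup hz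
      have h2 : (fun w => q.eval w * phi T u f w) = fun w =>
          ((∏ d ∈ s.erase z, (Polynomial.X - C d : ℂ[X])) ^ n).eval w * ((w - z) ^ (n - k z) *
            ((w - z) ^ (k z) • phi T u f w)) := by
        funext w
        rw [hq, ← Finset.mul_prod_erase s _ hz, mul_pow, eval_mul, eval_pow, eval_sub, eval_X,
          eval_C, smul_eq_mul, ← mul_assoc ((w - z) ^ (n - k z)), ← pow_add,
          Nat.sub_add_cancel hle]
        ring
      rw [h2]
      have h3 := h1.differentiableAt
      exact (Polynomial.differentiable _ z).mul
        ((((differentiable_id.sub_const z).pow _) z).mul h3)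
    · have hzr : z ∈ resolventSet ℂ T := by
        by_contra hh
        exact hz (hs hh)
      exact (Polynomial.differentiable _ z).mul (phi_diff u f hzr)
  obtain ⟨e, he, he'⟩ := phi_aeval (T := T) u f q
  set v := (aeval T q : X →L[ℂ] X) u with hv
  have hres : ∀ᶠ z in cocompact ℂ, z ∈ resolventSet ℂ T := by
    have := (spectrum.isCompact (𝕜 := ℂ) T).compl_mem_cocompact
    filter_upwards [this] with z hz
    by_contra hh
    exact hz hh
  have htend : Tendsto (fun z => q.eval z * phi T u f z + e z) (cocompact ℂ) (𝓝 0) := by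
    refine (tendsto_phi (T := T) v f).congr' ?_
    filter_upwards [hres] with z hz using he' z hz
  have hzero : ∀ z ∈ resolventSet ℂ T, phi T v f z = 0 := by
    intro z hz
    rw [he' z hz]
    exact (hE.add he).apply_eq_of_tendsto_cocompact z htend
  apply h n
  rw [← hqa]
  change f v = 0
  have h1 : Tendsto (fun _ : ℂ => -f v) (cocompact ℂ) (𝓝 0) := by
    refine (tendsto_phi (T := T) (T v) f).congr' ?_
    filter_upwards [hres] with z hz
    have h2 : f (resolvent T z v) = 0 := hzero z hz
    simp [phi, res_T hz, h2]
  have h2 : -f v = 0 := tendsto_nhds_unique tendsto_const_nhds h1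
  simpa using h2

lemma casorati (u : X) (f : X →L[ℂ] ℂ) (d : ℂ)
    (hd : ∀ᶠ z in 𝓝[≠] d, z ∈ resolventSet ℂ T) (hm : ¬ MeromorphicAt (phi T u f) d) :
    ∀ η > 0, Dense (phi T u f '' (resolventSet ℂ T ∩ ball d η)) := by
  intro η hη
  by_contra hcon
  apply hm
  rw [Metric.dense_iff] at hcon
  push Not at hcon
  obtain ⟨c, r, hr, hcr⟩ := hcon
  obtain ⟨η', hη', hsub⟩ := Metric.mem_nhdsWithin_iff.mp hd
  set s : Set ℂ := ball d (min η η') with hsdef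
  have hsn : s ∈ 𝓝 d := ball_mem_nhds d (lt_min hη hη')
  have hsr : ∀ z ∈ s \ {d}, z ∈ resolventSet ℂ T :=
    fun z hz => hsub ⟨ball_subset_ball (min_le_right _ _) hz.1, hz.2⟩
  have hlow : ∀ z ∈ s \ {d}, r ≤ ‖phi T u f z - c‖ := by
    intro z hz
    by_contra hh
    push Not at hh
    have : phi T u f z ∈ ball c r ∩ phi T u f '' (resolventSet ℂ T ∩ ball d η) :=
      ⟨by rwa [mem_ball_iff_norm], z, ⟨hsr z hz, ball_subset_ball (min_le_left _ _) hz.1⟩, rfl⟩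
    rw [hcr] at this
    exact this
  have hne : ∀ z ∈ s \ {d}, phi T u f z - c ≠ 0 := fun z hz h0 => by
    have := hlow z hz
    rw [h0, norm_zero] at this
    linarith
  set g : ℂ → ℂ := fun z => (phi T u f z - c)⁻¹ with hg
  have hgd : DifferentiableOn ℂ g (s \ {d}) := fun z hz =>
    (((phi_diff u f (hsr z hz)).sub_const c).inv (hne z hz)).differentiableWithinAt
  have hgb : BddAbove (norm ∘ g '' (s \ {d})) := by
    refine ⟨r⁻¹, ?_⟩
    rintro _ ⟨z, hz, rfl⟩
    simp only [Function.comp, hg, norm_inv]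
    exact inv_anti₀ hr (hlow z hz)
  have hup := Complex.differentiableOn_update_limUnder_of_bddAbove hsn hgd hgb
  have h1 : MeromorphicAt g d := by
    refine (hup.analyticAt hsn).meromorphicAt.congr ?_
    filter_upwards [self_mem_nhdsWithin] with z hz
    exact Function.update_of_ne hz _ _
  have h2 : MeromorphicAt (fun z => (g z)⁻¹ + c) d := h1.inv.add (MeromorphicAt.const c d)
  refine h2.congr ?_
  refine Filter.Eventually.of_forall fun z => ?_
  simp [hg]

lemma good_of_finite (hX : ¬ FiniteDimensional ℂ X) (ε : ℝ) (hε : 0 < ε)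
    (hfin : (spectrum ℂ T).Finite) : Good T ε := by
  set s := hfin.toFinset with hs
  have hsc : (s : Set ℂ) = spectrum ℂ T := hfin.coe_toFinset
  by_cases hn : ∃ n : ℕ, (aeval T (∏ d ∈ s, (Polynomial.X - C d : ℂ[X]))) ^ n = 0
  · obtain ⟨n, hn⟩ := hn
    exact good_zero T ε hε (halfspace_of_algebraic hX T s n hn)
  · push Not at hn
    obtain ⟨u, f, huf⟩ := exists_nonvanishing _ hn
    obtain ⟨d, hds, hd⟩ := exists_not_meromorphic s hsc.ge u f huf
    have hdsp : d ∈ spectrum ℂ T := by rw [← hsc]; exact hds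
    refine good_of_dense ε hε u f d hdsp (casorati u f d ?_ hd)
    have h1 : (spectrum ℂ T \ {d}).Finite := hfin.subset sdiff_subset
    have h2 : (spectrum ℂ T \ {d})ᶜ ∈ 𝓝 d := h1.isClosed.isOpen_compl.mem_nhds (fun h => h.2 rfl)
    filter_upwards [self_mem_nhdsWithin, mem_nhdsWithin_of_mem_nhds h2] with z hz1 hz2
    by_contra hh
    exact hz2 ⟨hh, hz1⟩

/-- Baire category argument. -/
lemma good_of_baire (ε : ℝ) (hε : 0 < ε) (d : ℂ) (hd : d ∈ spectrum ℂ T)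
    (H : Submodule ℂ (X →L[ℂ] ℂ)) (hH : IsClosed (H : Set (X →L[ℂ] ℂ)))
    (h : ∀ (u : X), ∀ f ∈ H, ∀ δ > 0, ∀ η > 0, ∀ c : ℂ, ∃ u' : X, ∃ f' ∈ H, ‖u' - u‖ < δ ∧
      ‖f' - f‖ < δ ∧ ∃ z ∈ resolventSet ℂ T ∩ ball d η, phi T u' f' z = c) : Good T ε := by
  have : CompleteSpace H := hH.completeSpace_coe
  let b := TopologicalSpace.countableBasis ℂ
  have hbc : Countable b := (TopologicalSpace.countable_countableBasis ℂ).to_subtype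
  let O : ℕ × b → Set (X × H) := fun i =>
    {p | ∃ z ∈ resolventSet ℂ T ∩ ball d (1 / (i.1 + 1)), phi T p.1 p.2 z ∈ (i.2 : Set ℂ)}
  have hO : ∀ i, IsOpen (O i) := by
    rintro ⟨n, U⟩
    have hU : IsOpen (U : Set ℂ) := TopologicalSpace.isOpen_of_mem_countableBasis U.2
    have heq : O (n, U) = ⋃ z ∈ resolventSet ℂ T ∩ ball d (1 / (n + 1)),
        {p : X × H | phi T p.1 p.2 z ∈ (U : Set ℂ)} := by
      ext p
      simp only [O, mem_ofPred_eq, mem_iUnion, exists_prop]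
    rw [heq]
    refine isOpen_biUnion fun z _ => hU.preimage ?_
    unfold phi
    have h1 : Continuous fun p : X × H => (p.2 : X →L[ℂ] ℂ) := by fun_prop
    have h2 : Continuous fun p : X × H => resolvent T z p.1 := by fun_prop
    exact h1.clm_apply h2
  have hD : ∀ i, Dense (O i) := by
    rintro ⟨n, U⟩
    have hUne : (U : Set ℂ).Nonempty := TopologicalSpace.nonempty_of_mem_countableBasis U.2
    obtain ⟨c, hc⟩ := hUne
    rw [Metric.dense_iff]
    rintro ⟨u, f, hf⟩ r hr
    obtain ⟨u', f', hf', h1, h2, z, hz, hzc⟩ := h u f hf r hr (1 / (n + 1)) (by positivity) c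
    refine ⟨(u', ⟨f', hf'⟩), ?_, z, hz, ?_⟩
    · rw [mem_ball, Prod.dist_eq, max_lt_iff]
      refine ⟨by rwa [dist_eq_norm], ?_⟩
      rw [Subtype.dist_eq, dist_eq_norm]
      exact h2
    · change phi T u' f' z ∈ (U : Set ℂ)
      rw [hzc]; exact hc
  obtain ⟨⟨u, f⟩, huf⟩ := (dense_iInter_of_isOpen hO hD).nonempty
  rw [mem_iInter] at huf
  refine good_of_dense ε hε u f d hd ?_
  intro η hη
  obtain ⟨n, hn⟩ := exists_nat_one_div_lt hη
  rw [(TopologicalSpace.isBasis_countableBasis ℂ).dense_iff]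
  intro U hU _
  obtain ⟨z, hz, hzU⟩ := huf (n, ⟨U, hU⟩)
  exact ⟨_, hzU, z, ⟨hz.1, ball_subset_ball hn.le hz.2⟩, rfl⟩

lemma quadratic (A B D c : ℂ) (δ : ℝ) (hδ : 0 < δ) (hD : D ≠ 0) (h : ‖A - c‖ ≤ δ ^ 2 * ‖D‖) :
    ∃ s : ℂ, ‖s‖ ≤ δ ∧ A + s * B + s ^ 2 * D = c := by
  obtain ⟨w, hw⟩ := IsAlgClosed.exists_pow_nat_eq (B ^ 2 - 4 * D * (A - c)) (n := 2) (by norm_num)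
  set s₁ := (-B + w) / (2 * D) with hs1
  set s₂ := (-B - w) / (2 * D) with hs2
  have e1 : A + s₁ * B + s₁ ^ 2 * D = c := by
    rw [hs1]; field_simp; linear_combination hw
  have e2 : A + s₂ * B + s₂ ^ 2 * D = c := by
    rw [hs2]; field_simp; linear_combination hw
  have e3 : s₁ * s₂ * D = A - c := by
    rw [hs1, hs2]; field_simp; linear_combination -hw
  by_cases h1 : ‖s₁‖ ≤ δ
  · exact ⟨s₁, h1, e1⟩
  by_cases h2 : ‖s₂‖ ≤ δ
  · exact ⟨s₂, h2, e2⟩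
  exfalso
  push Not at h1 h2
  rw [← e3, norm_mul, norm_mul] at h
  have h3 : δ ^ 2 < ‖s₁‖ * ‖s₂‖ := by nlinarith
  have h4 := mul_lt_mul_of_pos_right h3 (norm_pos_iff.mpr hD)
  linarith

lemma perturb (u : X) (f : X →L[ℂ] ℂ) (z : ℂ) (a : X) (b : X →L[ℂ] ℂ) (c : ℂ) (δ : ℝ) (hδ : 0 < δ)
    (ha : ‖a‖ ≤ 1) (hb : ‖b‖ ≤ 1) (hD : phi T a b z ≠ 0)
    (h : ‖phi T u f z - c‖ ≤ δ ^ 2 * ‖phi T a b z‖) :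
    ∃ s : ℂ, ‖s • a‖ ≤ δ ∧ ‖s • b‖ ≤ δ ∧ phi T (u + s • a) (f + s • b) z = c := by
  obtain ⟨s, hs, hsc⟩ := quadratic _ (phi T a f z + phi T u b z) _ c δ hδ hD h
  refine ⟨s, ?_, ?_, ?_⟩
  · rw [norm_smul]; nlinarith [norm_nonneg s, norm_nonneg a]
  · rw [norm_smul]; nlinarith [norm_nonneg s, norm_nonneg b]
  · rw [← hsc]
    simp only [phi, map_add, map_smul, add_apply, smul_apply, smul_eq_mul]
    ring

lemma exists_near {d : ℂ} (hd : d ∈ frontier (spectrum ℂ T)) {s : Set ℂ} (hs : s ∈ 𝓝 d) :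
    ∃ z ∈ resolventSet ℂ T, z ∈ s := by
  rw [frontier_eq_closure_inter_closure] at hd
  obtain ⟨z, hz1, hz2⟩ := mem_closure_iff_nhds.mp hd.2 s hs
  refine ⟨z, ?_, hz1⟩
  by_contra hh
  exact hz2 hh

lemma frontier_sub : frontier (spectrum ℂ T) ⊆ spectrum ℂ T :=
  (spectrum.isClosed (𝕜 := ℂ) T).frontier_subset

lemma good_of_denseRange (ε : ℝ) (hε : 0 < ε) (d : ℂ) (hd : d ∈ frontier (spectrum ℂ T))
    (hr : DenseRange fun v => T v - d • v) : Good T ε := by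
  have hds := frontier_sub hd
  refine good_of_baire ε hε d hds ⊤ isClosed_univ ?_
  intro u f _ δ hδ η hη c
  obtain ⟨v, hv⟩ := hr.exists_dist_lt u (half_pos hδ)
  rw [dist_comm, dist_eq_norm] at hv
  set u₀ := T v - d • v with hu₀
  set δ' := δ / 4 with hδ'
  have hδ'0 : 0 < δ' := by positivity
  set K := 2 * (‖f‖ * ‖v‖) + ‖c‖ with hK
  have hK0 : 0 ≤ K := by positivity
  obtain ⟨z, hz, hzb⟩ := exists_near hd
    (ball_mem_nhds d (lt_min hη (show 0 < δ' ^ 2 / (2 * (K + 1)) by positivity)))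
  rw [mem_ball_iff_norm, lt_min_iff] at hzb
  obtain ⟨hz1, hz2⟩ := hzb
  have htr := norm_res_ge hz hds
  set t := ‖z - d‖ with ht
  have ht0 : 0 ≤ t := norm_nonneg _
  set r := ‖resolvent T z‖ with hrr
  have hr0 : 0 < r := by
    by_contra hh
    have : r = 0 := le_antisymm (not_lt.mp hh) (norm_nonneg _)
    rw [this] at htr; linarith
  obtain ⟨a, ha, har⟩ := (resolvent T z).exists_lt_apply_of_lt_opNorm (half_lt_self hr0)
  obtain ⟨b, hb, hba⟩ := exists_dual_vector'' ℂ (resolvent T z a)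
  have hphi : ‖phi T a b z‖ = ‖resolvent T z a‖ := by
    unfold phi
    rw [hba]; simp
  have hA : phi T u₀ f z = (z - d) * f (resolvent T z v) - f v := by
    simp only [phi, hu₀, map_sub, map_smul, res_T hz, smul_eq_mul]
    ring
  have hfv : ‖f v‖ ≤ ‖f‖ * ‖v‖ := f.le_opNorm v
  have hfr : ‖f (resolvent T z v)‖ ≤ r * (‖f‖ * ‖v‖) := by
    calc _ ≤ ‖f‖ * ‖resolvent T z v‖ := f.le_opNorm _
      _ ≤ ‖f‖ * (r * ‖v‖) := by gcongr; exact (resolvent T z).le_opNorm v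
      _ = _ := by ring
  have hbound : ‖phi T u₀ f z - c‖ ≤ t * r * K := by
    have h1 : ‖phi T u₀ f z - c‖ ≤ t * (r * (‖f‖ * ‖v‖)) + ‖f‖ * ‖v‖ + ‖c‖ := by
      rw [hA]
      refine (norm_sub_le _ _).trans ?_
      gcongr
      refine (norm_sub_le _ _).trans ?_
      rw [norm_mul]
      gcongr
    have h2 : 0 ≤ ‖f‖ * ‖v‖ + ‖c‖ := by positivity
    have h3 := mul_le_mul_of_nonneg_right htr h2
    rw [hK]
    linarith
  have htK : t * K ≤ δ' ^ 2 / 2 := by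
    rw [lt_div_iff₀ (by positivity)] at hz2
    nlinarith
  have hfinal : ‖phi T u₀ f z - c‖ ≤ δ' ^ 2 * ‖phi T a b z‖ := by
    rw [hphi]
    calc _ ≤ t * r * K := hbound
      _ = (t * K) * r := by ring
      _ ≤ δ' ^ 2 / 2 * r := by gcongr
      _ = δ' ^ 2 * (r / 2) := by ring
      _ ≤ _ := by gcongr
  obtain ⟨s, hs1, hs2, hs3⟩ := perturb u₀ f z a b c δ' hδ'0 ha.le hb (by
    rw [← norm_pos_iff, hphi]; linarith) hfinal
  refine ⟨u₀ + s • a, f + s • b, trivial, ?_, ?_, z, ⟨hz, ?_⟩, hs3⟩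
  · have : u₀ + s • a - u = (u₀ - u) + s • a := by abel
    rw [this]
    refine (norm_add_le _ _).trans_lt ?_
    linarith
  · rw [add_sub_cancel_left]
    linarith
  · rwa [mem_ball_iff_norm]

lemma exists_dual_eigen (d : ℂ) (hr : ¬ DenseRange fun v => T v - d • v) :
    ∃ g : X →L[ℂ] ℂ, (∀ v, g (T v) = d * g v) ∧ ‖g‖ ≤ 1 ∧ ∃ a : X, ‖a‖ ≤ 1 ∧ g a ≠ 0 := by
  set R : Submodule ℂ X := LinearMap.range ((T - d • ContinuousLinearMap.id ℂ X : X →L[ℂ] X)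
    : X →ₗ[ℂ] X) with hR
  have hne : ∃ x, x ∉ R.topologicalClosure := by
    by_contra hcon
    push Not at hcon
    apply hr
    intro x
    have h1 := hcon x
    rw [← SetLike.mem_coe, Submodule.topologicalClosure_coe] at h1
    have hset : (range fun v => T v - d • v) = (R : Set X) := by
      ext y
      constructor
      · rintro ⟨v, rfl⟩
        exact ⟨v, by simp⟩
      · rintro ⟨v, rfl⟩
        exact ⟨v, by simp⟩
    rw [hset]
    exact h1
  obtain ⟨x, hx⟩ := hne
  obtain ⟨g, hg0, hg1⟩ := hahn_banach_sub _ R.isClosed_topologicalClosure hx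
  have hgne : g ≠ 0 := by
    rintro rfl
    simp at hg1
  have hxne : x ≠ 0 := by
    rintro rfl
    simp at hg1
  have hgn : 0 < ‖g‖ := norm_pos_iff.mpr hgne
  refine ⟨((‖g‖⁻¹ : ℝ) : ℂ) • g, ?_, ?_, ((‖x‖⁻¹ : ℝ) : ℂ) • x, ?_, ?_⟩
  · intro v
    have h1 : g (T v - d • v) = 0 := hg0 _ (R.le_topologicalClosure ⟨v, by simp⟩)
    rw [map_sub, map_smul, sub_eq_zero, smul_eq_mul] at h1
    simp only [smul_apply, smul_eq_mul, h1]
    ring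
  · rw [norm_smul, Complex.norm_real, norm_inv, norm_norm, inv_mul_cancel₀ hgn.ne']
  · rw [norm_smul, Complex.norm_real, norm_inv, norm_norm,
      inv_mul_cancel₀ (norm_ne_zero_iff.mpr hxne)]
  · simp [hg1, hgne, hxne]

lemma phi_eigen {d z : ℂ} (hz : z ∈ resolventSet ℂ T) {g : X →L[ℂ] ℂ}
    (hg : ∀ v, g (T v) = d * g v) (u : X) : (z - d) * phi T u g z = g u := by
  have h1 := congrArg g (T_res hz u)
  rw [hg, map_sub, map_smul, smul_eq_mul] at h1
  unfold phi
  linear_combination -h1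

lemma locBdd_eigen (u : X) (g : X →L[ℂ] ℂ) (e' : ℂ) (he' : ∀ v, g (T v) = e' * g v)
    (e : ℂ) (he : e ≠ e') :
    ∃ K : ℝ, ∀ᶠ z in 𝓝 e, z ∈ resolventSet ℂ T → ‖phi T u g z‖ ≤ K := by
  have hne : e - e' ≠ 0 := sub_ne_zero.mpr he
  generalize hw : g u = w
  have hcont : ContinuousAt (fun z : ℂ => ‖w / (z - e')‖) e :=
    (ContinuousAt.div continuousAt_const (continuousAt_id.sub continuousAt_const) hne).norm
  refine ⟨‖w / (e - e')‖ + 1, ?_⟩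
  have h1 : ∀ᶠ z in 𝓝 e, ‖w / (z - e')‖ < ‖w / (e - e')‖ + 1 :=
    hcont.eventually (Iio_mem_nhds (lt_add_one ‖w / (e - e')‖))
  have h2 : ∀ᶠ z in 𝓝 e, z ≠ e' := isOpen_ne.mem_nhds he
  filter_upwards [h1, h2] with z hz1 hz2 hz
  have h3 := phi_eigen hz he' u
  have h4 : phi T u g z = w / (z - e') := by
    rw [eq_div_iff (sub_ne_zero.mpr hz2), ← hw, ← h3]; ring
  rw [h4]
  exact le_of_lt hz1

/-- The eigenvectors of the transpose of `T`. -/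
def dualEigen (T : X →L[ℂ] X) : Set (X →L[ℂ] ℂ) := {g | ∃ e : ℂ, ∀ v, g (T v) = e * g v}

lemma locBdd_span (u : X) (f : X →L[ℂ] ℂ) (hf : f ∈ Submodule.span ℂ (dualEigen T)) :
    ∃ s : Set ℂ, s.Finite ∧ ∀ e ∉ s, ∃ K : ℝ,
      ∀ᶠ z in 𝓝 e, z ∈ resolventSet ℂ T → ‖phi T u f z‖ ≤ K := by
  induction hf using Submodule.span_induction with
  | mem g hg =>
    obtain ⟨e', he'⟩ := hg
    exact ⟨{e'}, finite_singleton _, fun e he => locBdd_eigen u g e' he' e he⟩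
  | zero =>
    refine ⟨∅, finite_empty, fun e _ => ⟨0, Filter.Eventually.of_forall fun z _ => ?_⟩⟩
    have : phi T u 0 z = 0 := rfl
    rw [this, norm_zero]
  | add f g _ _ hf hg =>
    obtain ⟨s1, hs1, h1⟩ := hf
    obtain ⟨s2, hs2, h2⟩ := hg
    refine ⟨s1 ∪ s2, hs1.union hs2, fun e he => ?_⟩
    obtain ⟨K1, hK1⟩ := h1 e (fun h => he (Or.inl h))
    obtain ⟨K2, hK2⟩ := h2 e (fun h => he (Or.inr h))
    refine ⟨K1 + K2, ?_⟩
    filter_upwards [hK1, hK2] with z hz1 hz2 hz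
    exact (norm_add_le _ _).trans (add_le_add (hz1 hz) (hz2 hz))
  | smul a f _ hf =>
    obtain ⟨s1, hs1, h1⟩ := hf
    refine ⟨s1, hs1, fun e he => ?_⟩
    obtain ⟨K1, hK1⟩ := h1 e he
    refine ⟨‖a‖ * K1, ?_⟩
    filter_upwards [hK1] with z hz1 hz
    have : phi T u (a • f) z = a * phi T u f z := rfl
    rw [this, norm_mul]
    exact mul_le_mul_of_nonneg_left (hz1 hz) (norm_nonneg a)

lemma good_of_infinite_frontier (ε : ℝ) (hε : 0 < ε) (hinf : (frontier (spectrum ℂ T)).Infinite)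
    (hr : ∀ d ∈ frontier (spectrum ℂ T), ¬ DenseRange fun v => T v - d • v) : Good T ε := by
  obtain ⟨d, hds, hacc⟩ := hinf.exists_accPt_of_subset_isCompact
    (spectrum.isCompact (𝕜 := ℂ) T) frontier_sub
  refine good_of_baire ε hε d hds (Submodule.span ℂ (dualEigen T)).topologicalClosure
    (Submodule.isClosed_topologicalClosure _) ?_
  intro u f hf δ hδ η hη c
  obtain ⟨f₀, hf₀, hff⟩ := Metric.mem_closure_iff.mp hf (δ / 2) (half_pos hδ)
  rw [dist_comm, dist_eq_norm] at hff
  set δ' := δ / 4 with hδ'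
  have hδ'0 : 0 < δ' := by positivity
  obtain ⟨s, hs, hsK⟩ := locBdd_span u f₀ hf₀
  -- a spectral boundary point near `d` outside the finite set `s`
  obtain ⟨e, hef, heb, hes⟩ : ∃ e ∈ frontier (spectrum ℂ T), e ∈ ball d η ∧ e ∉ s := by
    have hU : ball d η ∩ (s \ {d})ᶜ ∈ 𝓝 d := Filter.inter_mem (ball_mem_nhds d hη)
      ((hs.subset sdiff_subset).isClosed.isOpen_compl.mem_nhds (fun h => h.2 rfl))
    obtain ⟨e, ⟨⟨h1, h2⟩, h3⟩, h4⟩ := accPt_iff_nhds.mp hacc _ hU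
    exact ⟨e, h3, h1, fun h => h2 ⟨h, h4⟩⟩
  obtain ⟨K, hK⟩ := hsK e hes
  obtain ⟨g, hg, hgn, a, ha, hga⟩ := exists_dual_eigen e (hr e hef)
  have hga0 : 0 < ‖g a‖ := norm_pos_iff.mpr hga
  have hsmall : ∀ᶠ z in 𝓝 e, ‖z - e‖ * (K + ‖c‖) < δ' ^ 2 * ‖g a‖ := by
    have hcont : ContinuousAt (fun z : ℂ => ‖z - e‖ * (K + ‖c‖)) e := by fun_prop
    refine hcont.eventually (Iio_mem_nhds ?_)
    simp only [sub_self, norm_zero, zero_mul]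
    positivity
  obtain ⟨z, hz, ⟨hzK, hzs⟩, hzb⟩ := exists_near hef
    (Filter.inter_mem (Filter.inter_mem hK hsmall) (isOpen_ball.mem_nhds heb))
  have hzK' : ‖phi T u f₀ z‖ ≤ K := hzK hz
  have hzs' : ‖z - e‖ * (K + ‖c‖) < δ' ^ 2 * ‖g a‖ := hzs
  have hphi := phi_eigen hz hg a
  have hne : phi T a g z ≠ 0 := by
    intro h0
    rw [h0, mul_zero] at hphi
    exact hga hphi.symm
  have hze : 0 < ‖z - e‖ := by
    rw [norm_pos_iff]
    intro h0
    rw [h0, zero_mul] at hphi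
    exact hga hphi.symm
  obtain ⟨t, ht1, ht2, ht3⟩ := perturb u f₀ z a g c δ' hδ'0 ha hgn hne (by
    have h1 : ‖phi T u f₀ z - c‖ ≤ K + ‖c‖ := (norm_sub_le _ _).trans (by linarith)
    rw [← hphi, norm_mul] at hzs'
    have h2 : ‖z - e‖ * (K + ‖c‖) < ‖z - e‖ * (δ' ^ 2 * ‖phi T a g z‖) := by linarith
    exact h1.trans (lt_of_mul_lt_mul_left h2 hze.le).le)
  refine ⟨u + t • a, f₀ + t • g, ?_, ?_, ?_, z, ⟨hz, hzb⟩, ht3⟩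
  · exact Submodule.le_topologicalClosure _ (Submodule.add_mem _ hf₀
      (Submodule.smul_mem _ _ (Submodule.subset_span ⟨e, hg⟩)))
  · rw [add_sub_cancel_left]
    linarith
  · have : f₀ + t • g - f = (f₀ - f) + t • g := by abel
    rw [this]
    refine (norm_add_le _ _).trans_lt ?_
    linarith

lemma finite_of_frontier (h : (frontier (spectrum ℂ T)).Finite) : (spectrum ℂ T).Finite := by
  refine h.subset ?_
  have hconn : IsPreconnected (frontier (spectrum ℂ T))ᶜ :=
    (h.countable.isConnected_compl_of_one_lt_rank (by simp)).isPreconnected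
  have hcl := spectrum.isClosed (𝕜 := ℂ) T
  intro z hz
  by_contra hzf
  have hzi : z ∈ interior (spectrum ℂ T) := by
    by_contra hh
    exact hzf (hcl.frontier_eq ▸ ⟨hz, hh⟩)
  have hne : (spectrum ℂ T)ᶜ.Nonempty := by
    by_contra hh
    rw [not_nonempty_iff_eq_empty, compl_empty_iff] at hh
    have := (spectrum.isCompact (𝕜 := ℂ) T)
    rw [hh] at this
    exact noncompact_univ ℂ this
  obtain ⟨w, hw⟩ := hne
  obtain ⟨y, hy1, hy2, hy3⟩ := hconn (interior (spectrum ℂ T)) (spectrum ℂ T)ᶜ isOpen_interior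
    hcl.isOpen_compl (by
      intro y hy
      by_cases hys : y ∈ spectrum ℂ T
      · left
        by_contra hh
        exact hy (hcl.frontier_eq ▸ ⟨hys, hh⟩)
      · exact Or.inr hys)
    ⟨z, hzf, hzi⟩ ⟨w, fun hh => hw (frontier_sub hh), hw⟩
  exact hy3 (interior_subset hy2)

end Resolvent

end RankOneHalfspace

/-- **Invariant half-space after a small rank-one perturbation.**
For any bounded operator `T` on an infinite-dimensional complex Banach space `X`
and any `ε > 0`, there is an operator `F` of rank at most one with `‖F‖ ≤ ε`
such that `T + F` has an invariant closed subspace of infinite dimension and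
infinite codimension (a half-space). -/
theorem rank_one_perturbation_invariant_halfspace
    (X : Type*) [NormedAddCommGroup X] [NormedSpace ℂ X] [CompleteSpace X]
    (hX : ¬ FiniteDimensional ℂ X) (T : X →L[ℂ] X) (ε : ℝ) (hε : 0 < ε) :
    ∃ F : X →L[ℂ] X,
      Module.rank ℂ (LinearMap.range (F : X →ₗ[ℂ] X)) ≤ 1 ∧ ‖F‖ ≤ ε ∧
      ∃ Y : Submodule ℂ X, IsClosed (Y : Set X) ∧
        ¬ FiniteDimensional ℂ Y ∧ ¬ FiniteDimensional ℂ (X ⧸ Y) ∧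
        ∀ y ∈ Y, (T + F) y ∈ Y := by
  change RankOneHalfspace.Good T ε
  by_cases h1 : ∃ d ∈ frontier (spectrum ℂ T), DenseRange fun v => T v - d • v
  · obtain ⟨d, hd, hr⟩ := h1
    exact RankOneHalfspace.good_of_denseRange ε hε d hd hr
  · push Not at h1
    by_cases h2 : (frontier (spectrum ℂ T)).Finite
    · exact RankOneHalfspace.good_of_finite hX ε hε (RankOneHalfspace.finite_of_frontier h2)
    · exact RankOneHalfspace.good_of_infinite_frontier ε hε h2 h1
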